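/- The total number of n-domino towers (over all base lengths b with 1 ≤ b ≤ n) equals 4^(n−1) for all n ≥ 1. -/

import Mathlib

/-- The dominoes of `D` at level `y`, identified by the x-coordinate of their left cell. -/
def rowSet (D : Finset (ℤ × ℕ)) (y : ℕ) : Finset ℤ :=
  (D.filter (fun p => p.2 = y)).image Prod.fst

/-- Dominoes at the same level do not overlap. -/
def NoOverlap (D : Finset (ℤ × ℕ)) : Prop :=
  ∀ p ∈ D, (p.1 + 1, p.2) ∉ D

/-- Every domino above the base is supported by a domino one level below,
at horizontal offset `-1`, `0`, or `+1`. -/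
def Supported (D : Finset (ℤ × ℕ)) : Prop :=
  ∀ (x : ℤ) (y : ℕ), (x, y + 1) ∈ D →
    (x - 1, y) ∈ D ∨ (x, y) ∈ D ∨ (x + 1, y) ∈ D

/-- `D` is an `(n,b)`-domino tower: `n` dominoes in total, the level-0 dominoes form a
contiguous horizontal base of `b` dominoes (normalized to start at `x = 0`),
no two dominoes overlap, and every non-base domino is supported. -/
def IsDominoTower (n b : ℕ) (D : Finset (ℤ × ℕ)) : Prop :=
  D.card = n ∧
  rowSet D 0 = (Finset.range b).image (fun t : ℕ => 2 * (t : ℤ)) ∧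
  NoOverlap D ∧ Supported D

/-- The positions concurrent with a domino at `x`. -/
def concurrent (x : ℤ) : Finset ℤ := {x - 1, x, x + 1}

/-- The positions concurrent with some domino of the row `S`. -/
def nbhd (S : Finset ℤ) : Finset ℤ := S.biUnion concurrent

/-- The dominoes of the row `S` do not overlap. -/
def Sparse (S : Finset ℤ) : Prop := ∀ x ∈ S, x + 1 ∉ S

/-- Towers of `m` dominoes whose bottom row is `S`. -/
def towersOn (S : Finset ℤ) (m : ℤ) : Set (Finset (ℤ × ℕ)) :=
  {D | (D.card : ℤ) = m ∧ rowSet D 0 = S ∧ NoOverlap D ∧ Supported D}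

/-- Towers of `m` dominoes whose bottom row is contained in `A`. -/
def towersIn (A : Finset ℤ) (m : ℤ) : Set (Finset (ℤ × ℕ)) :=
  {D | (D.card : ℤ) = m ∧ rowSet D 0 ⊆ A ∧ NoOverlap D ∧ Supported D}

/-- Put the tower `D` on top of the row `S`. -/
def stack (S : Finset ℤ) (D : Finset (ℤ × ℕ)) : Finset (ℤ × ℕ) :=
  S.image (fun x => (x, 0)) ∪ D.image (fun p => (p.1, p.2 + 1))

theorem mem_rowSet {D : Finset (ℤ × ℕ)} {y : ℕ} {x : ℤ} : x ∈ rowSet D y ↔ (x, y) ∈ D := by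
  simp [rowSet]

theorem mem_concurrent {x z : ℤ} : z ∈ concurrent x ↔ z = x - 1 ∨ z = x ∨ z = x + 1 := by
  simp [concurrent]

theorem mem_nbhd {S : Finset ℤ} {x : ℤ} : x ∈ nbhd S ↔ x - 1 ∈ S ∨ x ∈ S ∨ x + 1 ∈ S := by
  simp only [nbhd, Finset.mem_biUnion, mem_concurrent]
  constructor
  · rintro ⟨a, ha, rfl | rfl | rfl⟩ <;> simp [ha]
  · rintro (h | h | h)
    · exact ⟨_, h, by simp⟩
    · exact ⟨_, h, by simp⟩
    · exact ⟨_, h, by simp⟩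

theorem nbhd_insert (S : Finset ℤ) (x : ℤ) : nbhd (insert x S) = nbhd S ∪ concurrent x := by
  rw [nbhd, Finset.biUnion_insert, Finset.union_comm, nbhd]

theorem mem_stack_zero {S : Finset ℤ} {D : Finset (ℤ × ℕ)} {x : ℤ} :
    (x, 0) ∈ stack S D ↔ x ∈ S := by
  simp [stack]

theorem mem_stack_succ {S : Finset ℤ} {D : Finset (ℤ × ℕ)} {x : ℤ} {y : ℕ} :
    (x, y + 1) ∈ stack S D ↔ (x, y) ∈ D := by
  simp [stack]

theorem card_stack (S : Finset ℤ) (D : Finset (ℤ × ℕ)) :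
    (stack S D).card = S.card + D.card := by
  rw [stack, Finset.card_union_of_disjoint, Finset.card_image_of_injective,
    Finset.card_image_of_injective]
  · rintro ⟨a, b⟩ ⟨c, d⟩ h
    simpa using h
  · intro a b h
    simpa using h
  · simp [Finset.disjoint_left]

theorem stack_injective (S : Finset ℤ) : Function.Injective (stack S) := by
  intro D E h
  ext ⟨x, y⟩
  rw [← mem_stack_succ (S := S), h, mem_stack_succ]

theorem towersOn_eq_image {S : Finset ℤ} (hS : Sparse S) (m : ℤ) :
    towersOn S m = stack S '' towersIn (nbhd S) (m - S.card) := by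
  ext D
  constructor
  · rintro ⟨hc, hr, hno, hsup⟩
    have hinj : Function.Injective (fun p : ℤ × ℕ => (p.1, p.2 + 1)) := by
      rintro ⟨a, b⟩ ⟨c, d⟩ h
      simpa using h
    obtain ⟨E, hE⟩ : ∃ E : Finset (ℤ × ℕ), ∀ x y, (x, y) ∈ E ↔ (x, y + 1) ∈ D :=
      ⟨D.preimage _ hinj.injOn, fun x y => by simp⟩
    have hD : stack S E = D := by
      ext ⟨x, y⟩
      cases y with
      | zero => rw [mem_stack_zero, ← hr, mem_rowSet]
      | succ y => rw [mem_stack_succ, hE]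
    refine ⟨E, ⟨?_, ?_, ?_, ?_⟩, hD⟩
    · rw [← hc, ← hD, card_stack]
      push_cast
      ring
    · intro x hx
      rw [mem_rowSet, hE] at hx
      rw [mem_nbhd, ← hr]
      simpa only [mem_rowSet] using hsup x 0 hx
    · rintro ⟨x, y⟩ hp
      rw [hE] at hp ⊢
      exact hno _ hp
    · intro x y h
      simp only [hE] at h ⊢
      exact hsup _ _ h
  · rintro ⟨E, ⟨hc, hr, hno, hsup⟩, rfl⟩
    refine ⟨?_, ?_, ?_, ?_⟩
    · rw [card_stack]
      push_cast
      omega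
    · ext x
      rw [mem_rowSet, mem_stack_zero]
    · rintro ⟨x, _ | y⟩ hp
      · rw [mem_stack_zero] at hp ⊢
        exact hS _ hp
      · rw [mem_stack_succ] at hp ⊢
        exact hno _ hp
    · rintro x (_ | y) h
      · rw [mem_stack_succ] at h
        simp only [mem_stack_zero]
        exact mem_nbhd.1 (hr (mem_rowSet.2 h))
      · simp only [mem_stack_succ] at h ⊢
        exact hsup _ _ h

theorem encard_towersOn {S : Finset ℤ} (hS : Sparse S) (m : ℤ) :
    (towersOn S m).encard = (towersIn (nbhd S) (m - S.card)).encard := by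
  rw [towersOn_eq_image hS, (stack_injective S).encard_image]

theorem encard_towersOn_of_not_sparse {S : Finset ℤ} (hS : ¬ Sparse S) (m : ℤ) :
    (towersOn S m).encard = 0 := by
  rw [Set.encard_eq_zero, Set.eq_empty_iff_forall_notMem]
  rintro D ⟨-, rfl, hno, -⟩
  refine hS fun x hx hx' => ?_
  rw [mem_rowSet] at hx hx'
  exact hno _ hx hx'

theorem encard_towersIn (A : Finset ℤ) (m : ℤ) :
    (towersIn A m).encard = ∑ S ∈ A.powerset, (towersOn S m).encard := by
  have h : towersIn A m = ⋃ S ∈ (A.powerset : Set (Finset ℤ)), towersOn S m := by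
    ext D
    simp [towersIn, towersOn]
    tauto
  rw [h, (Finset.finite_toSet _).encard_biUnion, finsum_mem_coe_finset]
  intro S _ T _ hST
  refine Set.disjoint_left.2 fun D hS hT => hST ?_
  rw [← hS.2.1, hT.2.1]

theorem encard_towersIn_of_neg (A : Finset ℤ) {m : ℤ} (hm : m < 0) :
    (towersIn A m).encard = 0 := by
  rw [Set.encard_eq_zero, Set.eq_empty_iff_forall_notMem]
  rintro D ⟨h, -⟩
  omega

theorem encard_towersIn_zero (A : Finset ℤ) : (towersIn A 0).encard = 1 := by
  rw [Set.encard_eq_one]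
  refine ⟨∅, ?_⟩
  ext D
  constructor
  · rintro ⟨h, -⟩
    simpa using h
  · rintro rfl
    simp [towersIn, rowSet, NoOverlap, Supported]

theorem encard_towersIn_empty {m : ℤ} (hm : 0 < m) : (towersIn ∅ m).encard = 0 := by
  rw [Set.encard_eq_zero, Set.eq_empty_iff_forall_notMem]
  rintro D ⟨hc, hr, -, hsup⟩
  have key : ∀ y x, (x, y) ∉ D := by
    intro y
    induction y with
    | zero => exact fun x hx => by simpa using hr (mem_rowSet.2 hx)
    | succ y ih =>
      intro x hx
      rcases hsup x y hx with h | h | h <;> exact ih _ h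
  have : D = ∅ := Finset.eq_empty_of_forall_notMem fun ⟨x, y⟩ => key y x
  simp [this] at hc
  omega

theorem sparse_insert_iff {S : Finset ℤ} {y : ℤ} (hy : y ∉ S) :
    Sparse (insert y S) ↔ Sparse S ∧ y ∉ nbhd S := by
  simp only [Sparse, mem_nbhd, Finset.mem_insert]
  constructor
  · intro h
    refine ⟨fun x hx hx' => h x (.inr hx) (.inr hx'), ?_⟩
    rintro (h' | h' | h')
    · exact h _ (.inr h') (.inl (by ring))
    · exact hy h'
    · exact h y (.inl rfl) (.inr h')
  · rintro ⟨h, h'⟩ x (rfl | hx) (hx' | hx')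
    · omega
    · exact h' (.inr (.inr hx'))
    · exact h' (.inl (by rwa [← hx', add_sub_cancel_right]))
    · exact h x hx hx'

theorem encard_towersOn_insert {S : Finset ℤ} {y : ℤ} (hS : Sparse S) (hy : y ∉ S) (m : ℤ) :
    (towersOn (insert y S) m).encard =
      if y ∈ nbhd S then 0 else (towersIn (nbhd S ∪ concurrent y) (m - S.card - 1)).encard := by
  split_ifs with h
  · exact encard_towersOn_of_not_sparse (by rw [sparse_insert_iff hy]; tauto) m
  · rw [encard_towersOn ((sparse_insert_iff hy).2 ⟨hS, h⟩), nbhd_insert,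
      Finset.card_insert_of_notMem hy]
    push_cast
    rw [sub_sub]

/-- Filling the neighbourhood of `x` one position at a time. -/
theorem encard_towersIn_union_concurrent {j : ℤ}
    (ih : ∀ i ≤ j, ∀ (A : Finset ℤ) (x : ℤ), x ∉ A → (towersIn (insert x A) i).encard =
      (towersIn A i).encard + (towersIn (A ∪ concurrent x) (i - 1)).encard)
    {B : Finset ℤ} {x : ℤ} (hx : x ∉ B) :
    (towersIn (B ∪ concurrent x) j).encard =
      (towersIn B j).encard
      + (if x + 1 ∈ B then 0 else (towersIn (B ∪ concurrent (x + 1)) (j - 1)).encard)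
      + (towersIn (B ∪ concurrent x) (j - 1)).encard
      + (if x - 1 ∈ B then 0 else (towersIn (B ∪ concurrent (x - 1)) (j - 1)).encard)
      + (if x + 1 ∈ B ∨ x - 1 ∈ B then 0 else
          (towersIn (B ∪ concurrent (x + 1) ∪ concurrent (x - 1)) (j - 1 - 1)).encard) := by
  have e1 : B ∪ concurrent x = insert (x + 1) (insert x (insert (x - 1) B)) := by
    ext z
    simp only [Finset.mem_union, mem_concurrent, Finset.mem_insert]
    tauto
  have h1 : (towersIn (insert (x - 1) B) j).encard = (towersIn B j).encard +
      (if x - 1 ∈ B then 0 else (towersIn (B ∪ concurrent (x - 1)) (j - 1)).encard) := by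
    split_ifs with h
    · rw [Finset.insert_eq_of_mem h, add_zero]
    · exact ih j le_rfl _ _ h
  have h2 : (towersIn (insert x (insert (x - 1) B)) j).encard =
      (towersIn (insert (x - 1) B) j).encard + (towersIn (B ∪ concurrent x) (j - 1)).encard := by
    rw [ih j le_rfl _ _ (by simp [hx]; omega)]
    congr 3
    ext z
    simp only [Finset.mem_union, mem_concurrent, Finset.mem_insert]
    tauto
  have h3 : (towersIn (insert (x + 1) (insert x (insert (x - 1) B))) j).encard =
      (towersIn (insert x (insert (x - 1) B)) j).encard +
      (if x + 1 ∈ B then 0 else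
        (towersIn (insert (x - 1) (B ∪ concurrent (x + 1))) (j - 1)).encard) := by
    split_ifs with h
    · rw [Finset.insert_eq_of_mem (by simp [h]), add_zero]
    · rw [ih j le_rfl _ _ (by simp [h]; omega)]
      congr 3
      ext z
      simp only [Finset.mem_union, mem_concurrent, Finset.mem_insert, add_sub_cancel_right]
      tauto
  have h4 : (towersIn (insert (x - 1) (B ∪ concurrent (x + 1))) (j - 1)).encard =
      (towersIn (B ∪ concurrent (x + 1)) (j - 1)).encard + (if x - 1 ∈ B then 0 else
        (towersIn (B ∪ concurrent (x + 1) ∪ concurrent (x - 1)) (j - 1 - 1)).encard) := by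
    split_ifs with h
    · rw [Finset.insert_eq_of_mem (by simp [h]), add_zero]
    · refine ih (j - 1) (by omega) _ _ ?_
      simp only [Finset.mem_union, mem_concurrent, h, false_or]
      omega
  rw [congrArg (fun A => (towersIn A j).encard) e1, h3, h2, h1, h4]
  by_cases ha : x + 1 ∈ B <;> by_cases hb : x - 1 ∈ B <;> simp only [ha, hb, if_true, if_false,
    or_true, or_false] <;> ring

/-- Inserting a domino at `x` or at most two dominoes around `x` into a row `S`. -/
theorem encard_towersOn_insert_eq_sum {m : ℤ}
    (ih : ∀ i < m, ∀ (A : Finset ℤ) (x : ℤ), x ∉ A → (towersIn (insert x A) i).encard =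
      (towersIn A i).encard + (towersIn (A ∪ concurrent x) (i - 1)).encard)
    {S : Finset ℤ} {x : ℤ} (hd : ∀ z ∈ concurrent x, z ∉ S) :
    (towersOn (insert x S) m).encard =
      (towersOn S (m - 1)).encard
      + (towersOn (insert (x + 1) S) (m - 1)).encard
      + (towersOn (insert x S) (m - 1)).encard
      + (towersOn (insert (x - 1) S) (m - 1)).encard
      + (towersOn (insert (x - 1) (insert (x + 1) S)) (m - 1)).encard := by
  have hl : x - 1 ∉ S := hd _ (by simp [mem_concurrent])
  have hx : x ∉ S := hd _ (by simp [mem_concurrent])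
  have hr : x + 1 ∉ S := hd _ (by simp [mem_concurrent])
  have hl' : x - 1 ∉ insert (x + 1) S := by
    simp only [Finset.mem_insert, hl, or_false]
    omega
  by_cases hS : Sparse S
  · have hxn : x ∉ nbhd S := by
      rw [mem_nbhd]
      tauto
    have hboth : (towersOn (insert (x - 1) (insert (x + 1) S)) (m - 1)).encard =
        if x + 1 ∈ nbhd S ∨ x - 1 ∈ nbhd S then 0 else
          (towersIn (nbhd S ∪ concurrent (x + 1) ∪ concurrent (x - 1))
            (m - S.card - 1 - 1 - 1)).encard := by
      by_cases h : x + 1 ∈ nbhd S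
      · rw [if_pos (.inl h)]
        refine encard_towersOn_of_not_sparse ?_ _
        rw [sparse_insert_iff hl', sparse_insert_iff hr]
        tauto
      · have hiff : x - 1 ∈ nbhd S ∪ concurrent (x + 1) ↔ x + 1 ∈ nbhd S ∨ x - 1 ∈ nbhd S := by
          rw [Finset.mem_union, mem_concurrent]
          simp only [h, false_or, or_iff_left_iff_imp]
          omega
        rw [encard_towersOn_insert ((sparse_insert_iff hr).2 ⟨hS, h⟩) hl', nbhd_insert,
          Finset.card_insert_of_notMem hr, if_congr hiff rfl rfl]
        push_cast
        ring_nf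
    rw [hboth, encard_towersOn_insert hS hx, encard_towersOn_insert hS hx,
      encard_towersOn_insert hS hr, encard_towersOn_insert hS hl, encard_towersOn hS,
      if_neg hxn, if_neg hxn,
      encard_towersIn_union_concurrent (fun i hi => ih i (by omega)) hxn,
      sub_right_comm m 1]
  · rw [encard_towersOn_of_not_sparse hS]
    simp only [hS, hl, hx, hr, hl', sparse_insert_iff, false_and, not_false_eq_true,
      encard_towersOn_of_not_sparse, add_zero]

/-- A tower over `insert x A` either avoids `x` in its bottom row, or is obtained by pushing up
a tower over `A ∪ concurrent x` and inserting a domino at `x`. -/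
theorem encard_towersIn_insert (m : ℤ) (A : Finset ℤ) (x : ℤ) (hx : x ∉ A) :
    (towersIn (insert x A) m).encard =
      (towersIn A m).encard + (towersIn (A ∪ concurrent x) (m - 1)).encard := by
  suffices H : ∀ (n : ℕ) (m : ℤ), m < n → ∀ (A : Finset ℤ) (x : ℤ), x ∉ A →
      (towersIn (insert x A) m).encard =
        (towersIn A m).encard + (towersIn (A ∪ concurrent x) (m - 1)).encard from
    H (m.toNat + 1) m (by omega) A x hx
  clear hx x A m
  intro n
  induction n with
  | zero =>
    intro m hm A x _
    have hm' : m < 0 := by simpa using hm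
    simp [encard_towersIn_of_neg _ hm', encard_towersIn_of_neg _ (show m - 1 < 0 by omega)]
  | succ n ih =>
    intro m hm A x hx
    push_cast at hm
    rw [encard_towersIn, Finset.sum_powerset_insert hx, ← encard_towersIn]
    congr 1
    have hsub : ∑ S ∈ A.powerset, (towersOn (insert x S) m).encard =
        ∑ S ∈ (A \ concurrent x).powerset, (towersOn (insert x S) m).encard := by
      symm
      refine Finset.sum_subset (Finset.powerset_mono.2 Finset.sdiff_subset) fun S hS hS' => ?_
      rw [Finset.mem_powerset] at hS hS'
      have hxS : x ∉ S := fun h => hx (hS h)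
      refine encard_towersOn_of_not_sparse (fun h => hS' fun z hz => ?_) m
      rw [sparse_insert_iff hxS, mem_nbhd] at h
      rw [Finset.mem_sdiff, mem_concurrent]
      refine ⟨hS hz, ?_⟩
      rintro (rfl | rfl | rfl) <;> tauto
    have e : A ∪ concurrent x =
        insert (x - 1) (insert x (insert (x + 1) (A \ concurrent x))) := by
      ext z
      simp only [Finset.mem_union, mem_concurrent, Finset.mem_insert, Finset.mem_sdiff]
      tauto
    have n3 : x + 1 ∉ A \ concurrent x := by simp [mem_concurrent]
    have n2 : x ∉ insert (x + 1) (A \ concurrent x) := by simp [mem_concurrent]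
    have n1 : x - 1 ∉ insert x (insert (x + 1) (A \ concurrent x)) := by
      simp [mem_concurrent]
      omega
    rw [hsub, e, encard_towersIn,
      Finset.sum_powerset_insert n1, Finset.sum_powerset_insert n2, Finset.sum_powerset_insert n2,
      Finset.sum_powerset_insert n3, Finset.sum_powerset_insert n3, Finset.sum_powerset_insert n3,
      Finset.sum_powerset_insert n3]
    simp only [← Finset.sum_add_distrib]
    refine Finset.sum_congr rfl fun S hS => ?_
    rw [Finset.mem_powerset] at hS
    have hd : ∀ z ∈ concurrent x, z ∉ S := fun z hz hzS => (Finset.mem_sdiff.1 (hS hzS)).2 hz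
    have hadj : ∀ T : Finset ℤ, x - 1 ∈ T → x ∈ T → (towersOn T (m - 1)).encard = 0 :=
      fun T h h' => encard_towersOn_of_not_sparse
        (fun hT => hT _ h (by rwa [sub_add_cancel])) _
    have hadj' : (towersOn (insert x (insert (x + 1) S)) (m - 1)).encard = 0 :=
      encard_towersOn_of_not_sparse (fun hT => hT x (by simp) (by simp)) _
    rw [hadj', hadj (insert (x - 1) (insert x S)) (by simp) (by simp),
      hadj (insert (x - 1) (insert x (insert (x + 1) S))) (by simp) (by simp),
      encard_towersOn_insert_eq_sum (fun i hi => ih i (by omega)) hd]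
    ring

theorem encard_towersIn_Ico_succ (a : ℤ) (l m : ℕ) :
    (towersIn (Finset.Ico a (a + l + 1)) m).encard = ((2 * m + l - 1).choose m : ℕ) := by
  induction m generalizing a l with
  | zero => simp [encard_towersIn_zero]
  | succ m ihm =>
    induction l with
    | zero =>
      have e : Finset.Ico a (a + (0 : ℕ) + 1) = insert a ∅ := by
        ext z; simp; omega
      have e' : ∅ ∪ concurrent a = Finset.Ico (a - 1) (a - 1 + (2 : ℕ) + 1) := by
        ext z; simp [mem_concurrent]; omega
      rw [e, encard_towersIn_insert _ _ _ (by simp), encard_towersIn_empty (by positivity), e',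
        show ((m + 1 : ℕ) : ℤ) - 1 = m by push_cast; ring, ihm, zero_add]
      congr 1
      rw [show 2 * m + 2 - 1 = 2 * m + 1 by omega, show 2 * (m + 1) + 0 - 1 = 2 * m + 1 by omega,
        ← Nat.choose_symm_of_eq_add (show 2 * m + 1 = m + (m + 1) by ring)]
    | succ l ihl =>
      have e : Finset.Ico a (a + (l + 1 : ℕ) + 1) =
          insert (a + l + 1) (Finset.Ico a (a + l + 1)) := by
        ext z; simp; omega
      have e' : Finset.Ico a (a + l + 1) ∪ concurrent (a + l + 1) =
          Finset.Ico a (a + (l + 2 : ℕ) + 1) := by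
        ext z; simp [mem_concurrent]; omega
      rw [e, encard_towersIn_insert _ _ _ (by simp), ihl, e',
        show ((m + 1 : ℕ) : ℤ) - 1 = m by push_cast; ring, ihm]
      norm_cast
      rw [show 2 * (m + 1) + (l + 1) - 1 = 2 * m + l + 1 + 1 by omega,
        show 2 * (m + 1) + l - 1 = 2 * m + l + 1 by omega,
        show 2 * m + (l + 2) - 1 = 2 * m + l + 1 by omega, Nat.choose_succ_succ (2 * m + l + 1) m,
        add_comm]

/-- The base consisting of `b` contiguous dominoes. -/
def base (b : ℕ) : Finset ℤ := (Finset.range b).image (fun t : ℕ => 2 * (t : ℤ))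

theorem card_base (b : ℕ) : (base b).card = b := by
  rw [base, Finset.card_image_of_injective, Finset.card_range]
  intro x y h
  simpa using h

theorem sparse_base (b : ℕ) : Sparse (base b) := by
  intro x hx hx'
  simp only [base, Finset.mem_image] at hx hx'
  obtain ⟨s, -, hs⟩ := hx
  obtain ⟨t, -, ht⟩ := hx'
  omega

theorem nbhd_base {b : ℕ} (hb : 1 ≤ b) :
    nbhd (base b) = Finset.Ico (-1 : ℤ) (-1 + (2 * b : ℕ) + 1) := by
  have hmem : ∀ z, z ∈ base b ↔ 0 ≤ z ∧ z % 2 = 0 ∧ z < 2 * b := by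
    intro z
    simp only [base, Finset.mem_image, Finset.mem_range]
    constructor
    · rintro ⟨t, ht, rfl⟩
      omega
    · rintro ⟨h0, h1, h2⟩
      exact ⟨(z / 2).toNat, by omega, by omega⟩
  ext z
  rw [mem_nbhd, hmem, hmem, hmem, Finset.mem_Ico]
  push_cast
  omega

theorem encard_isDominoTower {n b : ℕ} (hb : 1 ≤ b) (hbn : b ≤ n) :
    {D | IsDominoTower n b D}.encard = ((2 * n - 1).choose (n - b) : ℕ) := by
  have h : {D | IsDominoTower n b D} = towersOn (base b) n := by
    ext D
    simp [IsDominoTower, towersOn, base]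
  rw [h, encard_towersOn (sparse_base b), nbhd_base hb, card_base, ← Nat.cast_sub hbn,
    encard_towersIn_Ico_succ]
  congr 3
  omega

/-- The total number of `n`-domino towers (over all base lengths `b` with `1 ≤ b ≤ n`)
equals `4 ^ (n - 1)` for all `n ≥ 1`. -/
theorem card_n_domino_towers (n : ℕ) (hn : 1 ≤ n) :
    {D : Finset (ℤ × ℕ) | ∃ b, 1 ≤ b ∧ b ≤ n ∧ IsDominoTower n b D}.ncard = 4 ^ (n - 1) := by
  have h : {D : Finset (ℤ × ℕ) | ∃ b, 1 ≤ b ∧ b ≤ n ∧ IsDominoTower n b D} =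
      ⋃ b ∈ (Finset.Icc 1 n : Set ℕ), {D | IsDominoTower n b D} := by
    ext D
    simp [and_assoc]
  have hdisj : (Finset.Icc 1 n : Set ℕ).PairwiseDisjoint
      (fun b => {D : Finset (ℤ × ℕ) | IsDominoTower n b D}) := by
    intro b _ c _ hbc
    refine Set.disjoint_left.2 fun D hb hc => hbc ?_
    rw [← card_base b, ← card_base c, base, base, ← hb.2.1, hc.2.1]
  rw [Set.ncard, h, (Finset.finite_toSet _).encard_biUnion hdisj, finsum_mem_coe_finset,
    Finset.sum_congr rfl fun b hb =>
      encard_isDominoTower (Finset.mem_Icc.1 hb).1 (Finset.mem_Icc.1 hb).2,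
    ← Nat.cast_sum, ENat.toNat_natCast]
  obtain ⟨m, rfl⟩ : ∃ m, n = m + 1 := ⟨n - 1, by omega⟩
  rw [Nat.add_sub_cancel, ← Nat.sum_range_choose_halfway m,
    show 2 * (m + 1) - 1 = 2 * m + 1 by omega]
  refine Finset.sum_bij' (fun b _ => m + 1 - b) (fun i _ => m + 1 - i) ?_ ?_ ?_ ?_ ?_ <;>
    simp <;> omega
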